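/- Key expansion (Lemma): a_{λ+ρ}(x|y) · s_μ(x|y) = Σ_{B ∈ B(μ)} c_{λ*B} · a_{λ+ρ+ω(B^u)}(x|y), summed over all reverse barred tableaux B of shape μ. -/

import Mathlib

open scoped Classical
open MvPolynomial

noncomputable section

namespace EqLR

/-- Ambient polynomial ring `ℂ[x_1,…,x_d ; y_i (i ∈ ℤ)]`.
The variables `x_j` are indexed by `Fin d` (so `x_{j+1} = X (Sum.inl j)`), and the
variables `y_i` are indexed by `ℤ` (only positive indices actually occur). -/
abbrev P (d : ℕ) := MvPolynomial (Fin d ⊕ ℤ) ℂ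

/-- The variable `y_i`. -/
def yI (d : ℕ) (i : ℤ) : P d := X (Sum.inr i)

/-- The variable `x_v` for a value `v ∈ {1,…,d}` (junk value `0` otherwise). -/
def xv (d : ℕ) (v : ℕ) : P d :=
  if h : v - 1 < d then X (Sum.inl ⟨v - 1, h⟩) else 0

/-- The component `ξ_v` of a vector `ξ ∈ ℕ^d`, for a (1-based) value `v ∈ {1,…,d}`. -/
def vecAt {d : ℕ} (ξ : Fin d → ℕ) (v : ℕ) : ℕ :=
  if h : v - 1 < d then ξ ⟨v - 1, h⟩ else 0

/-- `μ ∈ ℕ^d` is a partition:  `μ_1 ≥ μ_2 ≥ … ≥ μ_d`. -/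
def IsPartitionVec {d : ℕ} (μ : Fin d → ℕ) : Prop :=
  ∀ i j : Fin d, i ≤ j → μ j ≤ μ i

/-- `|μ| = μ_1 + ⋯ + μ_d`. -/
def wt {d : ℕ} (μ : Fin d → ℕ) : ℕ := ∑ i, μ i

/-- `ρ = (d-1, d-2, …, 0)`. -/
def rho (d : ℕ) : Fin d → ℕ := fun i => d - 1 - (i : ℕ)

/-- Cells `(r, c)` (both 0-based) of the Young/reverse Young diagram whose row `r` has
length `μ_{r+1}`.  For the reverse diagram, rows are numbered bottom-to-top and columns
right-to-left; for the ordinary Young diagram, top-to-bottom and left-to-right. -/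
def cells (d : ℕ) (μ : Fin d → ℕ) : Finset (ℕ × ℕ) :=
  (Finset.range d ×ˢ Finset.range (Finset.univ.sup μ + 1)).filter
    fun rc => ∃ h : rc.1 < d, rc.2 < μ ⟨rc.1, h⟩

/-- In the column reading word of a *reverse* diagram (columns right-to-left, i.e. in
increasing 0-based column index, each column read top-to-bottom, i.e. in decreasing
0-based row index), the cell `b` is read strictly before the cell `a`. -/
def revBefore (a b : ℕ × ℕ) : Prop := b.2 < a.2 ∨ (b.2 = a.2 ∧ a.1 < b.1)

/-- In the column reading word of an ordinary Young diagram (rightmost column first,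
each column read top-to-bottom), the cell `b` is read strictly before the cell `a`. -/
def youngBefore (a b : ℕ × ℕ) : Prop := a.2 < b.2 ∨ (b.2 = a.2 ∧ b.1 < a.1)

/-- A reverse tableau of shape `μ`: entries in `{1,…,d}`, weakly increasing along rows
(left to right) and strictly increasing down columns (top to bottom). -/
structure RevTableau (d : ℕ) (μ : Fin d → ℕ) where
  val : ℕ × ℕ → ℕ
  mem : ∀ a ∈ cells d μ, 1 ≤ val a ∧ val a ≤ d
  zero : ∀ a ∉ cells d μ, val a = 0
  row : ∀ r c : ℕ, (r, c + 1) ∈ cells d μ → val (r, c + 1) ≤ val (r, c)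
  col : ∀ r c : ℕ, (r + 1, c) ∈ cells d μ → val (r + 1, c) < val (r, c)

/-- The factor `x_v - y_{(d+1-v) + c(a) - r(a)}` attached to an entry of value `v` in
the cell `a` of the reverse diagram (`c(a) = a.2 + 1`, `r(a) = a.1 + 1`, 1-based). -/
def factor (d : ℕ) (v : ℕ) (a : ℕ × ℕ) : P d :=
  xv d v - yI d ((d : ℤ) + 1 - (v : ℤ) + (a.2 : ℤ) - (a.1 : ℤ))

/-- The factorial Schur function `s_μ(x|y) = Σ_R (x|y)^R`. -/
def fSchur (d : ℕ) (μ : Fin d → ℕ) : P d :=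
  ∑ᶠ R : RevTableau d μ, ∏ a ∈ cells d μ, factor d (R.val a) a

/-- The ordinary Schur function `s_μ(x) = Σ_R x^R`. -/
def schurX (d : ℕ) (μ : Fin d → ℕ) : P d :=
  ∑ᶠ R : RevTableau d μ, ∏ a ∈ cells d μ, xv d (R.val a)

/-- The subalgebra `ℂ[y]` of polynomials in the `y` variables only. -/
def ySub (d : ℕ) : Subalgebra ℂ (P d) :=
  Algebra.adjoin ℂ (Set.range fun i : ℤ => yI d i)

/-- `p` is symmetric in the `x` variables. -/
def SymmX {d : ℕ} (p : P d) : Prop :=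
  ∀ σ : Equiv.Perm (Fin d), rename (⇑(Equiv.sumCongr σ (Equiv.refl ℤ))) p = p

/-- The falling factorial power `(x_j | y)^k = (x_j - y_1)⋯(x_j - y_k)`. -/
def ffPow (d : ℕ) (j : Fin d) (k : ℕ) : P d :=
  ∏ i ∈ Finset.range k, (X (Sum.inl j) - yI d ((i : ℤ) + 1))

/-- `(x|y)^ξ = (x_1|y)^{ξ_1} ⋯ (x_d|y)^{ξ_d}`. -/
def xyPow (d : ℕ) (ξ : Fin d → ℕ) : P d := ∏ j : Fin d, ffPow d j (ξ j)

/-- The alternant `a_ξ(x|y) = det[(x_j|y)^{ξ_i}]`. -/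
def aDet (d : ℕ) (ξ : Fin d → ℕ) : P d :=
  Matrix.det (Matrix.of fun i j : Fin d => ffPow d j (ξ i))

/-! ### Skew barred tableaux of shape `λ*μ` -/

/-- A skew barred tableau of shape `λ*μ`: the Young diagram `λ` (placed above and to
the right of the reverse diagram `μ`) is filled with values in `{1,…,d}` (field `top`),
the reverse diagram `μ` is filled with values in `{1,…,d}` (field `bot`), some of whose
cells may be barred (field `barred`); values weakly increase along rows left-to-right
and strictly increase down columns, ignoring bars. -/
structure SkewBarredTableau (d : ℕ) (lam mu : Fin d → ℕ) where
  top : ℕ × ℕ → ℕ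
  bot : ℕ × ℕ → ℕ
  barred : ℕ × ℕ → Prop
  top_mem : ∀ a ∈ cells d lam, 1 ≤ top a ∧ top a ≤ d
  top_zero : ∀ a ∉ cells d lam, top a = 0
  bot_mem : ∀ a ∈ cells d mu, 1 ≤ bot a ∧ bot a ≤ d
  bot_zero : ∀ a ∉ cells d mu, bot a = 0
  barred_sub : ∀ a, barred a → a ∈ cells d mu
  top_row : ∀ r c : ℕ, (r, c + 1) ∈ cells d lam → top (r, c) ≤ top (r, c + 1)
  top_col : ∀ r c : ℕ, (r + 1, c) ∈ cells d lam → top (r, c) < top (r + 1, c)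
  bot_row : ∀ r c : ℕ, (r, c + 1) ∈ cells d mu → bot (r, c + 1) ≤ bot (r, c)
  bot_col : ∀ r c : ℕ, (r + 1, c) ∈ cells d mu → bot (r + 1, c) < bot (r, c)

namespace SkewBarredTableau

variable {d : ℕ} {lam mu : Fin d → ℕ}

/-- `ω(L^u_{<a})_k`: the number of `k`'s among the unbarred entries of `L` read strictly
before the `μ`-cell `a` in the unbarred column word (all of `λ` is read before `μ`). -/
def countBefore (L : SkewBarredTableau d lam mu) (a : ℕ × ℕ) (k : ℕ) : ℕ :=
  ((cells d lam).filter fun b => L.top b = k).card +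
  ((cells d mu).filter fun b => ¬ L.barred b ∧ L.bot b = k ∧ revBefore a b).card

/-- `ω(L^u_{≤a})_k`: as `countBefore`, but the entry of `a` itself is also counted when
`a` is unbarred. -/
def countUpTo (L : SkewBarredTableau d lam mu) (a : ℕ × ℕ) (k : ℕ) : ℕ :=
  ((cells d lam).filter fun b => L.top b = k).card +
  ((cells d mu).filter fun b => ¬ L.barred b ∧ L.bot b = k ∧ (revBefore a b ∨ b = a)).card

/-- Prefix content within the `λ`-part of the word. -/
def topCountUpTo (L : SkewBarredTableau d lam mu) (a : ℕ × ℕ) (k : ℕ) : ℕ :=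
  ((cells d lam).filter fun b => L.top b = k ∧ (youngBefore a b ∨ b = a)).card

/-- `ω(L^u)_k`: total content of the unbarred column word of `L`. -/
def content (L : SkewBarredTableau d lam mu) (k : ℕ) : ℕ :=
  ((cells d lam).filter fun b => L.top b = k).card +
  ((cells d mu).filter fun b => ¬ L.barred b ∧ L.bot b = k).card

/-- The unbarred column word of `L` is Yamanouchi: every prefix contains at least as
many `k`'s as `(k+1)`'s, for every `k ≥ 1`. -/
def Yamanouchi (L : SkewBarredTableau d lam mu) : Prop :=
  (∀ a ∈ cells d lam, ∀ k : ℕ, 1 ≤ k → L.topCountUpTo a (k + 1) ≤ L.topCountUpTo a k) ∧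
  (∀ a ∈ cells d mu, ¬ L.barred a → ∀ k : ℕ, 1 ≤ k →
      L.countUpTo a (k + 1) ≤ L.countUpTo a k)

/-- `L` is an equivariant Littlewood–Richardson skew tableau of shape `λ*μ` and unbarred
content `ν`. -/
def IsLR (L : SkewBarredTableau d lam mu) (ν : Fin d → ℕ) : Prop :=
  L.Yamanouchi ∧ ∀ i : Fin d, L.content ((i : ℕ) + 1) = ν i

/-- The index `|a|' + ω(L^u_{<a})_{|a|}` of the first `y` in the factor of `c_L` at a
barred cell `a`. -/
def eIdx (L : SkewBarredTableau d lam mu) (a : ℕ × ℕ) : ℤ :=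
  ((d : ℤ) + 1 - (L.bot a : ℤ)) + (L.countBefore a (L.bot a) : ℤ)

/-- The index `|a|' + c(a) - r(a)` of the second `y` in the factor of `c_L` at a barred
cell `a`. -/
def fIdx (L : SkewBarredTableau d lam mu) (a : ℕ × ℕ) : ℤ :=
  ((d : ℤ) + 1 - (L.bot a : ℤ)) + (a.2 : ℤ) - (a.1 : ℤ)

/-- The weight `c_L = ∏_{a barred} (y_{|a|'+ω(L^u_{<a})_{|a|}} - y_{|a|'+c(a)-r(a)})`. -/
def cWt (L : SkewBarredTableau d lam mu) : P d :=
  ∏ a ∈ (cells d mu).filter (fun a => L.barred a), (yI d (L.eIdx a) - yI d (L.fIdx a))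

/-- `Δ(a) = ω(L^u_{≤a})_{|a|} - c(a) + r(a)`. -/
def Δ (L : SkewBarredTableau d lam mu) (a : ℕ × ℕ) : ℤ :=
  (L.countUpTo a (L.bot a) : ℤ) - ((a.2 : ℤ) + 1) + ((a.1 : ℤ) + 1)

end SkewBarredTableau

/-! ### Reverse barred tableaux -/

/-- A reverse barred tableau of shape `μ`. -/
structure RevBarredTableau (d : ℕ) (μ : Fin d → ℕ) where
  val : ℕ × ℕ → ℕ
  barred : ℕ × ℕ → Prop
  mem : ∀ a ∈ cells d μ, 1 ≤ val a ∧ val a ≤ d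
  zero : ∀ a ∉ cells d μ, val a = 0
  barred_sub : ∀ a, barred a → a ∈ cells d μ
  row : ∀ r c : ℕ, (r, c + 1) ∈ cells d μ → val (r, c + 1) ≤ val (r, c)
  col : ∀ r c : ℕ, (r + 1, c) ∈ cells d μ → val (r + 1, c) < val (r, c)

namespace RevBarredTableau

variable {d : ℕ} {μ : Fin d → ℕ}

/-- `ω(B^u_{<a})_k`. -/
def countBefore (B : RevBarredTableau d μ) (a : ℕ × ℕ) (k : ℕ) : ℕ :=
  ((cells d μ).filter fun b => ¬ B.barred b ∧ B.val b = k ∧ revBefore a b).card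

/-- `ω(B^u_{≤a})_k` (including `a` itself when unbarred). -/
def countUpTo (B : RevBarredTableau d μ) (a : ℕ × ℕ) (k : ℕ) : ℕ :=
  ((cells d μ).filter fun b => ¬ B.barred b ∧ B.val b = k ∧ (revBefore a b ∨ b = a)).card

/-- `ω(B^u)_k`. -/
def content (B : RevBarredTableau d μ) (k : ℕ) : ℕ :=
  ((cells d μ).filter fun b => ¬ B.barred b ∧ B.val b = k).card

/-- `e_{ξ,B}(a) = (ξ + ω(B^u_{<a}))_{|a|}`. -/
def eIdx (B : RevBarredTableau d μ) (ξ : Fin d → ℕ) (a : ℕ × ℕ) : ℤ :=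
  (vecAt ξ (B.val a) : ℤ) + (B.countBefore a (B.val a) : ℤ)

/-- `f_B(a) = |a|' + c(a) - r(a)`. -/
def fIdx (B : RevBarredTableau d μ) (a : ℕ × ℕ) : ℤ :=
  ((d : ℤ) + 1 - (B.val a : ℤ)) + (a.2 : ℤ) - (a.1 : ℤ)

/-- `c_{ξ,B} = ∏_{a barred} (y_{e_{ξ,B}(a)} - y_{f_B(a)})`. -/
def cXi (B : RevBarredTableau d μ) (ξ : Fin d → ℕ) : P d :=
  ∏ a ∈ (cells d μ).filter (fun a => B.barred a), (yI d (B.eIdx ξ a) - yI d (B.fIdx a))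

/-- The unbarred column word of `λ*B` is Yamanouchi (the `λ`-part is the canonical
filling of `λ`, whose whole content `λ` is added to every prefix of `B^u`). -/
def StarYam (B : RevBarredTableau d μ) (lam : Fin d → ℕ) : Prop :=
  ∀ a ∈ cells d μ, ¬ B.barred a → ∀ k : ℕ, 1 ≤ k →
    vecAt lam (k + 1) + B.countUpTo a (k + 1) ≤ vecAt lam k + B.countUpTo a k

end RevBarredTableau

/-! ### Reverse hatted tableaux -/

/-- A hat decoration: none, left hat, or right hat. -/
inductive Hat where
  | unhatted : Hat
  | left : Hat
  | right : Hat
deriving DecidableEq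

/-- A reverse hatted tableau of shape `μ`. -/
structure RevHattedTableau (d : ℕ) (μ : Fin d → ℕ) where
  val : ℕ × ℕ → ℕ
  hat : ℕ × ℕ → Hat
  mem : ∀ a ∈ cells d μ, 1 ≤ val a ∧ val a ≤ d
  zero : ∀ a ∉ cells d μ, val a = 0
  hat_out : ∀ a ∉ cells d μ, hat a = Hat.unhatted
  row : ∀ r c : ℕ, (r, c + 1) ∈ cells d μ → val (r, c + 1) ≤ val (r, c)
  col : ∀ r c : ℕ, (r + 1, c) ∈ cells d μ → val (r + 1, c) < val (r, c)

namespace RevHattedTableau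

variable {d : ℕ} {μ : Fin d → ℕ}

/-- `ω(H^u_{<a})_k`: content of the unhatted column word of `H` read before `a`. -/
def countBefore (H : RevHattedTableau d μ) (a : ℕ × ℕ) (k : ℕ) : ℕ :=
  ((cells d μ).filter fun b => H.hat b = Hat.unhatted ∧ H.val b = k ∧ revBefore a b).card

/-- `ω(H^u)_k`. -/
def content (H : RevHattedTableau d μ) (k : ℕ) : ℕ :=
  ((cells d μ).filter fun b => H.hat b = Hat.unhatted ∧ H.val b = k).card

/-- `e_{ξ,H}(a) = (ξ + ω(H^u_{<a}))_{|a|}`. -/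
def eIdx (H : RevHattedTableau d μ) (ξ : Fin d → ℕ) (a : ℕ × ℕ) : ℤ :=
  (vecAt ξ (H.val a) : ℤ) + (H.countBefore a (H.val a) : ℤ)

/-- `f_H(a) = |a|' + c(a) - r(a)`. -/
def fIdx (H : RevHattedTableau d μ) (a : ℕ × ℕ) : ℤ :=
  ((d : ℤ) + 1 - (H.val a : ℤ)) + (a.2 : ℤ) - (a.1 : ℤ)

/-- `d_{ξ,H} = ∏_{a ∈ H^l} y_{e_{ξ,H}(a)} · ∏_{a ∈ H^r} (-y_{f_H(a)})`. -/
def dWt (H : RevHattedTableau d μ) (ξ : Fin d → ℕ) : P d :=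
  (∏ a ∈ (cells d μ).filter (fun a => H.hat a = Hat.left), yI d (H.eIdx ξ a)) *
  ∏ a ∈ (cells d μ).filter (fun a => H.hat a = Hat.right), (-(yI d (H.fIdx a)))

end RevHattedTableau

/-- `H̄ = B`: `H` unbars to the reverse barred tableau `B`. -/
def UnbarsTo {d : ℕ} {μ : Fin d → ℕ} (H : RevHattedTableau d μ)
    (B : RevBarredTableau d μ) : Prop :=
  H.val = B.val ∧ ∀ a, (H.hat a ≠ Hat.unhatted ↔ B.barred a)

/-- The simple transposition `σ_i` on values: exchanges `i` and `i+1`. -/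
def swapVal (i v : ℕ) : ℕ := if v = i then i + 1 else if v = i + 1 then i else v

/-- The action of `σ_i` on `ℕ^d` by permuting coordinates. -/
def swapVec {d : ℕ} (i : ℕ) (ξ : Fin d → ℕ) : Fin d → ℕ :=
  fun j => vecAt ξ (swapVal i ((j : ℕ) + 1))

/-! ### Reverse (barred) subtableaux -/

/-- A reverse subtableau of shape `μ`: each cell is empty (value `0`) or carries a value
in `{1,…,d}`; no row or column conditions. -/
structure RevSubTableau (d : ℕ) (μ : Fin d → ℕ) where
  val : ℕ × ℕ → ℕ
  mem : ∀ a ∈ cells d μ, val a ≤ d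
  zero : ∀ a ∉ cells d μ, val a = 0

/-- A reverse barred subtableau of shape `μ`: a reverse subtableau some of whose filled
cells are barred. -/
structure RevBarredSubTableau (d : ℕ) (μ : Fin d → ℕ) where
  val : ℕ × ℕ → ℕ
  barred : ℕ × ℕ → Prop
  mem : ∀ a ∈ cells d μ, val a ≤ d
  zero : ∀ a ∉ cells d μ, val a = 0
  barred_filled : ∀ a, barred a → a ∈ cells d μ ∧ val a ≠ 0

/-- `(x|y)^R` for a reverse subtableau `R`. -/
def RevSubTableau.xyProd {d : ℕ} {μ : Fin d → ℕ} (R : RevSubTableau d μ) : P d :=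
  ∏ a ∈ (cells d μ).filter (fun a => R.val a ≠ 0), factor d (R.val a) a

namespace RevBarredSubTableau

variable {d : ℕ} {μ : Fin d → ℕ}

/-- `ω(B^u_{<a})_k`: unbarred filled entries of value `k` read before `a`. -/
def countBefore (B : RevBarredSubTableau d μ) (a : ℕ × ℕ) (k : ℕ) : ℕ :=
  ((cells d μ).filter fun b => ¬ B.barred b ∧ B.val b = k ∧ revBefore a b).card

/-- `ω(B^u)_k`. -/
def content (B : RevBarredSubTableau d μ) (k : ℕ) : ℕ :=
  ((cells d μ).filter fun b => ¬ B.barred b ∧ B.val b = k).card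

/-- `e_{ξ,B}(a) = (ξ + ω(B^u_{<a}))_{|a|}`. -/
def eIdx (B : RevBarredSubTableau d μ) (ξ : Fin d → ℕ) (a : ℕ × ℕ) : ℤ :=
  (vecAt ξ (B.val a) : ℤ) + (B.countBefore a (B.val a) : ℤ)

/-- `f_B(a) = |a|' + c(a) - r(a)`. -/
def fIdx (B : RevBarredSubTableau d μ) (a : ℕ × ℕ) : ℤ :=
  ((d : ℤ) + 1 - (B.val a : ℤ)) + (a.2 : ℤ) - (a.1 : ℤ)

/-- `c_{ξ,B}`. -/
def cXi (B : RevBarredSubTableau d μ) (ξ : Fin d → ℕ) : P d :=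
  ∏ a ∈ (cells d μ).filter (fun a => B.barred a), (yI d (B.eIdx ξ a) - yI d (B.fIdx a))

end RevBarredSubTableau

end EqLR

namespace EqLR

section Algebra

variable {A : Type*} [CommRing A]

/-- The falling factorial power `(t - y_1)⋯(t - y_k)` in an arbitrary commutative ring. -/
def fallPow (y : ℤ → A) (t : A) (k : ℕ) : A := ∏ i ∈ Finset.range k, (t - y ((i : ℤ) + 1))

lemma fallPow_succ (y : ℤ → A) (t : A) (k : ℕ) :
    fallPow y t (k + 1) = fallPow y t k * (t - y ((k : ℤ) + 1)) :=
  Finset.prod_range_succ _ _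

/-- The alternant `det[(x_j - y_1)⋯(x_j - y_{ξ_i})]` in an arbitrary commutative ring. -/
def altDet (y : ℤ → A) (x : ℕ → A) (d : ℕ) (ξ : Fin d → ℕ) : A :=
  Matrix.det (Matrix.of fun i j : Fin d => fallPow y (x j) (ξ i))

/-- The weight of the skew strip between `μ` and an interlacing `ν`, all of whose entries
carry the variable `t`. -/
def stripWeight (y : ℤ → A) (t : A) {d : ℕ} (μ : Fin (d + 1) → ℕ) (ν : Fin d → ℕ) : A :=
  (∏ i : Fin d, ∏ c ∈ Finset.Ico (ν i) (μ i.castSucc),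
    (t - y ((d : ℤ) + 1 + (c : ℤ) - ((i : ℕ) : ℤ)))) * fallPow y t (μ (Fin.last d))

/-- The vectors interlacing `μ`. -/
def interlacing {d : ℕ} (μ : Fin (d + 1) → ℕ) : Finset (Fin d → ℕ) :=
  Fintype.piFinset fun i => Finset.Icc (μ i.succ) (μ i.castSucc)

lemma fallPow_sub_mul_fallPow (y : ℤ → A) (u t : A) (n a b : ℕ) (hab : a ≤ b) :
    fallPow y u (b + (n + 1)) -
        (∏ m ∈ Finset.Ico (a + n) (b + (n + 1)), (t - y ((m : ℤ) + 1))) * fallPow y u (a + n) =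
      (u - t) * ∑ c ∈ Finset.Icc a b,
        (∏ m ∈ Finset.Ico c b, (t - y ((n : ℤ) + 2 + (m : ℤ)))) * fallPow y u (c + n) := by
  induction b, hab using Nat.le_induction with
  | base =>
    have h : a + (n + 1) = a + n + 1 := rfl
    rw [h, fallPow_succ, Nat.Ico_succ_singleton]
    simp only [Finset.prod_singleton, Finset.Icc_self, Finset.sum_singleton, Finset.Ico_self,
      Finset.prod_empty]
    ring
  | succ b hab ih =>
    have h : b + 1 + (n + 1) = b + (n + 1) + 1 := by ring
    rw [h, fallPow_succ, Finset.prod_Ico_succ_top (by omega), ← Finset.Ico_succ_right_eq_Icc,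
      Nat.succ_eq_succ, Finset.sum_Ico_succ_top (by omega)]
    have h2 : ∑ c ∈ Finset.Ico a (b + 1),
        (∏ m ∈ Finset.Ico c (b + 1), (t - y ((n : ℤ) + 2 + (m : ℤ)))) * fallPow y u (c + n) =
        (t - y ((n : ℤ) + 2 + (b : ℤ))) * ∑ c ∈ Finset.Icc a b,
        (∏ m ∈ Finset.Ico c b, (t - y ((n : ℤ) + 2 + (m : ℤ)))) * fallPow y u (c + n) := by
      rw [Finset.mul_sum]
      refine Finset.sum_congr (by ext; simp) fun c hc => ?_
      rw [Finset.prod_Ico_succ_top (by simp at hc; omega)]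
      ring
    have e1 : (((b + (n + 1) : ℕ) : ℤ) + 1) = (n : ℤ) + 2 + (b : ℤ) := by push_cast; ring
    have e2 : b + 1 + n = b + (n + 1) := by ring
    rw [h2, e1, Finset.Ico_self, Finset.prod_empty, e2]
    linear_combination (t - y ((n : ℤ) + 2 + (b : ℤ))) * ih

/-- Subtracting from each row a multiple of the next one preserves the determinant. -/
lemma det_eq_of_forall_row_eq_smul_add_succ {d : ℕ} {M N : Matrix (Fin (d + 1)) (Fin (d + 1)) A}
    (q : Fin d → A) (hlast : ∀ j, M (Fin.last d) j = N (Fin.last d) j)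
    (h : ∀ (i : Fin d) (j), M i.castSucc j = N i.castSucc j + q i * M i.succ j) :
    M.det = N.det := by
  rw [← Matrix.det_submatrix_equiv_self Fin.revPerm M, ← Matrix.det_submatrix_equiv_self Fin.revPerm N]
  refine Matrix.det_eq_of_forall_row_eq_smul_add_pred (fun i => q i.rev) (fun j => ?_)
    fun i j => ?_
  · simpa using hlast _
  · simpa [Fin.rev_succ, Fin.rev_castSucc] using h i.rev j.rev

lemma altDet_succ (y : ℤ → A) (x : ℕ → A) {d : ℕ} (μ : Fin (d + 1) → ℕ)
    (hμ : IsPartitionVec μ) :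
    altDet y x (d + 1) (fun i => μ i + rho (d + 1) i) =
      (∏ j : Fin d, (x 0 - x ((j : ℕ) + 1))) * ∑ ν ∈ interlacing μ,
        stripWeight y (x 0) μ ν * altDet y (fun n => x (n + 1)) d (fun i => ν i + rho d i) := by
  set E : Fin d → ℕ → Fin d → A := fun i c j =>
    (∏ m ∈ Finset.Ico c (μ i.castSucc), (x 0 - y ((d : ℤ) + 1 + (m : ℤ) - ((i : ℕ) : ℤ)))) *
      fallPow y (x ((j : ℕ) + 1)) (c + rho d i) with hE
  have hrow : ∀ (u : A) (i : Fin d),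
      fallPow y u (μ i.castSucc + rho (d + 1) i.castSucc) -
        (∏ m ∈ Finset.Ico (μ i.succ + rho d i) (μ i.castSucc + (rho d i + 1)),
          (x 0 - y ((m : ℤ) + 1))) * fallPow y u (μ i.succ + rho (d + 1) i.succ) =
      (u - x 0) * ∑ c ∈ Finset.Icc (μ i.succ) (μ i.castSucc),
        (∏ m ∈ Finset.Ico c (μ i.castSucc),
          (x 0 - y ((d : ℤ) + 1 + (m : ℤ) - ((i : ℕ) : ℤ)))) * fallPow y u (c + rho d i) := by
    intro u i
    have h1 : rho (d + 1) i.castSucc = rho d i + 1 := by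
      have := i.isLt
      simp only [rho, Fin.val_castSucc]; omega
    have h2 : rho (d + 1) i.succ = rho d i := by
      simp only [rho, Fin.val_succ]; omega
    have h3 : ((rho d i : ℕ) : ℤ) = (d : ℤ) - 1 - ((i : ℕ) : ℤ) := by
      have := i.isLt
      simp only [rho]; omega
    rw [h1, h2, fallPow_sub_mul_fallPow y u (x 0) (rho d i) _ _
      (hμ _ _ (Fin.castSucc_lt_succ).le)]
    have h4 : ∀ m : ℕ, ((rho d i : ℕ) : ℤ) + 2 + (m : ℤ) =
        (d : ℤ) + 1 + (m : ℤ) - ((i : ℕ) : ℤ) := fun m => by rw [h3]; ring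
    simp only [h4]
  set N : Matrix (Fin (d + 1)) (Fin (d + 1)) A := Matrix.of fun i j =>
    Fin.lastCases (motive := fun _ => A) (fallPow y (x j) (μ (Fin.last d)))
      (fun i => (x j - x 0) * ∑ c ∈ Finset.Icc (μ i.succ) (μ i.castSucc),
        (∏ m ∈ Finset.Ico c (μ i.castSucc),
          (x 0 - y ((d : ℤ) + 1 + (m : ℤ) - ((i : ℕ) : ℤ)))) * fallPow y (x j) (c + rho d i)) i
    with hN
  have hdet : altDet y x (d + 1) (fun i => μ i + rho (d + 1) i) = N.det := by
    refine det_eq_of_forall_row_eq_smul_add_succ (fun i =>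
      ∏ m ∈ Finset.Ico (μ i.succ + rho d i) (μ i.castSucc + (rho d i + 1)),
          (x 0 - y ((m : ℤ) + 1))) (fun j => ?_) fun i j => ?_
    · simp [hN, rho]
    · have := hrow (x j) i
      simp only [hN, Matrix.of_apply, Fin.lastCases_castSucc]
      rw [← this]; ring
  have hminor : (N.submatrix (Fin.last d).succAbove Fin.succ).det =
      (∏ j : Fin d, (x ((j : ℕ) + 1) - x 0)) *
        Matrix.det (Matrix.of fun i j : Fin d =>
          ∑ c ∈ Finset.Icc (μ i.succ) (μ i.castSucc), E i c j) := by
    rw [← Matrix.det_mul_row]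
    congr 1
    ext i j
    simp [hN, hE]
  have hsum : Matrix.det (Matrix.of fun i j : Fin d =>
      ∑ c ∈ Finset.Icc (μ i.succ) (μ i.castSucc), E i c j) =
      ∑ ν ∈ interlacing μ, (∏ i : Fin d, ∏ c ∈ Finset.Ico (ν i) (μ i.castSucc),
        (x 0 - y ((d : ℤ) + 1 + (c : ℤ) - ((i : ℕ) : ℤ)))) *
        altDet y (fun n => x (n + 1)) d (fun i => ν i + rho d i) := by
    have h := (Matrix.detRowAlternating (n := Fin d) (R := A)).toMultilinearMap.map_sum_finset
      (fun i c => E i c) (fun i => Finset.Icc (μ i.succ) (μ i.castSucc))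
    have h5 : (Matrix.of fun i j : Fin d =>
        ∑ c ∈ Finset.Icc (μ i.succ) (μ i.castSucc), E i c j) =
        fun i => ∑ c ∈ Finset.Icc (μ i.succ) (μ i.castSucc), E i c := by
      ext i j; simp
    rw [h5]
    refine h.trans (Finset.sum_congr rfl fun ν _ => ?_)
    rw [altDet, ← Matrix.det_mul_column]
    rfl
  rw [hdet, Matrix.det_succ_column_zero, Finset.sum_eq_single (Fin.last d), hminor, hsum]
  · have hneg : (∏ j : Fin d, (x 0 - x ((j : ℕ) + 1))) =
        (-1) ^ d * ∏ j : Fin d, (x ((j : ℕ) + 1) - x 0) := by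
      rw [← Finset.card_fin d, ← Finset.prod_const, Finset.card_fin, ← Finset.prod_mul_distrib]
      exact Finset.prod_congr rfl fun j _ => by ring
    have hN0 : N (Fin.last d) 0 = fallPow y (x 0) (μ (Fin.last d)) := by simp [hN]
    rw [hneg, hN0, Fin.val_last]
    simp only [stripWeight]
    rw [Finset.mul_sum, Finset.mul_sum, Finset.mul_sum]
    exact Finset.sum_congr rfl fun ν _ => by ring
  · intro i _ hi
    obtain ⟨i, rfl⟩ := Fin.exists_castSucc_eq.2 hi
    simp [hN]
  · simp

end Algebra

section Tableaux

lemma mem_cells {d : ℕ} {μ : Fin d → ℕ} {r c : ℕ} :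
    (r, c) ∈ cells d μ ↔ ∃ h : r < d, c < μ ⟨r, h⟩ := by
  simp only [cells, Finset.mem_filter, Finset.mem_product, Finset.mem_range]
  refine ⟨fun h => h.2, fun h => ⟨⟨h.1, ?_⟩, h⟩⟩
  obtain ⟨h, hc⟩ := h
  exact hc.trans (Nat.lt_succ_of_le (Finset.le_sup (f := μ) (Finset.mem_univ _)))

lemma prod_cells {M : Type*} [CommMonoid M] {d : ℕ} (μ : Fin d → ℕ) (g : ℕ × ℕ → M) :
    ∏ a ∈ cells d μ, g a = ∏ i : Fin d, ∏ c ∈ Finset.range (μ i), g (i, c) := by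
  rw [Finset.prod_sigma']
  symm
  refine Finset.prod_bij (fun p _ => ((p.1 : ℕ), p.2)) ?_ ?_ ?_ fun _ _ => rfl
  · rintro ⟨i, c⟩ h
    exact mem_cells.2 ⟨i.isLt, by simpa using h⟩
  · rintro ⟨i, c⟩ _ ⟨j, c'⟩ _ h
    simp only [Prod.mk.injEq] at h
    obtain ⟨h1, rfl⟩ := h
    rw [Fin.ext h1]
  · rintro ⟨r, c⟩ h
    obtain ⟨hr, hc⟩ := mem_cells.1 h
    exact ⟨⟨⟨r, hr⟩, c⟩, by simpa using hc, rfl⟩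

namespace RevTableau

variable {d : ℕ} {μ : Fin d → ℕ}

@[ext]
lemma ext_val {R S : RevTableau d μ} (h : R.val = S.val) : R = S := by
  cases R; cases S; congr

lemma val_le (R : RevTableau d μ) (a : ℕ × ℕ) : R.val a ≤ d := by
  by_cases h : a ∈ cells d μ
  · exact (R.mem a h).2
  · simp [R.zero a h]

instance : Finite (RevTableau d μ) := by
  refine Finite.of_injective
    (fun (R : RevTableau d μ) (a : cells d μ) => (⟨R.val a, Nat.lt_succ_of_le (R.val_le a)⟩ :
      Fin (d + 1))) fun R S h => ?_
  ext a
  by_cases ha : a ∈ cells d μ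
  · simpa using congrFun h ⟨a, ha⟩
  · rw [R.zero a ha, S.zero a ha]

instance : Fintype (RevTableau d μ) := Fintype.ofFinite _

lemma val_add_row_le (hμ : IsPartitionVec μ) (R : RevTableau d μ) {r c : ℕ}
    (h : (r, c) ∈ cells d μ) : R.val (r, c) + r ≤ d := by
  induction r with
  | zero => exact (R.mem _ h).2
  | succ r ih =>
    have h1 : (r, c) ∈ cells d μ := by
      obtain ⟨hr, hc⟩ := mem_cells.1 h
      exact mem_cells.2 ⟨by omega, hc.trans_le (hμ _ _ (by simp [Fin.le_def]))⟩
    have := R.col r c h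
    have := ih h1
    omega

lemma val_antitone (R : RevTableau d μ) (r : ℕ) : Antitone fun c => R.val (r, c) := by
  refine antitone_nat_of_succ_le fun c => ?_
  by_cases h : (r, c + 1) ∈ cells d μ
  · exact R.row r c h
  · simp [R.zero _ h]

end RevTableau

lemma mem_interlacing {d : ℕ} {μ : Fin (d + 1) → ℕ} {ν : Fin d → ℕ} :
    ν ∈ interlacing μ ↔ ∀ i, μ i.succ ≤ ν i ∧ ν i ≤ μ i.castSucc := by
  simp [interlacing]

lemma isPartitionVec_of_mem_interlacing {d : ℕ} {μ : Fin (d + 1) → ℕ} {ν : Fin d → ℕ}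
    (hμ : IsPartitionVec μ) (h : ν ∈ interlacing μ) : IsPartitionVec ν := by
  rw [mem_interlacing] at h
  intro i j hij
  rcases hij.eq_or_lt with rfl | hij
  · exact le_rfl
  · exact (h j).2.trans ((hμ _ _ (by simpa [Fin.le_def] using hij)).trans (h i).1)

lemma cells_subset_of_mem_interlacing {d : ℕ} {μ : Fin (d + 1) → ℕ} {ν : Fin d → ℕ}
    (h : ν ∈ interlacing μ) : cells d ν ⊆ cells (d + 1) μ := by
  rintro ⟨r, c⟩ hrc
  obtain ⟨hr, hc⟩ := mem_cells.1 hrc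
  exact mem_cells.2 ⟨by omega, hc.trans_le ((mem_interlacing.1 h ⟨r, hr⟩).2)⟩

/-- Raise all entries of a reverse tableau by one and fill the new cells with ones. -/
def RevTableau.extend {d : ℕ} {μ : Fin (d + 1) → ℕ} {ν : Fin d → ℕ} (hν : ν ∈ interlacing μ)
    (R : RevTableau d ν) : RevTableau (d + 1) μ where
  val a := if a ∈ cells (d + 1) μ then R.val a + 1 else 0
  mem a ha := by
    have := R.val_le a
    simp only [ha, if_true]; omega
  zero a ha := by simp [ha]
  row r c h := by
    have h1 : (r, c) ∈ cells (d + 1) μ := by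
      obtain ⟨hr, hc⟩ := mem_cells.1 h
      exact mem_cells.2 ⟨hr, by omega⟩
    simpa [h, h1] using R.val_antitone r (Nat.le_succ c)
  col r c h := by
    obtain ⟨hr, hc⟩ := mem_cells.1 h
    have h1 : (r, c) ∈ cells d ν :=
      mem_cells.2 ⟨by omega, hc.trans_le (mem_interlacing.1 hν ⟨r, by omega⟩).1⟩
    simp only [h, cells_subset_of_mem_interlacing hν h1, if_true, Nat.add_lt_add_iff_right]
    by_cases h2 : (r + 1, c) ∈ cells d ν
    · exact R.col r c h2
    · rw [R.zero _ h2]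
      exact (R.mem _ h1).1

lemma RevTableau.extend_val {d : ℕ} {μ : Fin (d + 1) → ℕ} {ν : Fin d → ℕ}
    (hν : ν ∈ interlacing μ) (R : RevTableau d ν) {a : ℕ × ℕ} (ha : a ∈ cells (d + 1) μ) :
    (R.extend hν).val a = R.val a + 1 := if_pos ha

/-- Every reverse tableau with entries at most `d + 1` arises uniquely by extension. -/
lemma RevTableau.extend_bijective {d : ℕ} {μ : Fin (d + 1) → ℕ} (hμ : IsPartitionVec μ) :
    Function.Bijective fun p : (ν : interlacing μ) × RevTableau d ν.1 => p.2.extend p.1.2 := by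
  constructor
  · rintro ⟨⟨ν, hν⟩, R⟩ ⟨⟨κ, hκ⟩, S⟩ h
    have hval : R.val = S.val := by
      ext a
      by_cases ha : a ∈ cells (d + 1) μ
      · have := congrArg (fun T => T.val a) h
        simpa [RevTableau.extend_val _ _ ha] using this
      · rw [R.zero a fun h' => ha (cells_subset_of_mem_interlacing hν h'),
          S.zero a fun h' => ha (cells_subset_of_mem_interlacing hκ h')]
    have hcells : ∀ a, a ∈ cells d ν ↔ a ∈ cells d κ := by
      intro a
      constructor
      · intro ha
        by_contra hb
        have := (R.mem a ha).1
        rw [hval, S.zero a hb] at this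
        omega
      · intro ha
        by_contra hb
        have := (S.mem a ha).1
        rw [← hval, R.zero a hb] at this
        omega
    obtain rfl : ν = κ := by
      ext i
      refine eq_of_forall_lt_iff fun c => ?_
      simpa [mem_cells] using hcells (i, c)
    rw [RevTableau.ext_val hval]
  · intro T
    set ν : Fin d → ℕ := fun i =>
      ((Finset.range (μ i.castSucc)).filter fun c => 2 ≤ T.val ((i : ℕ), c)).card with hν
    have hlt : ∀ (i : Fin d) (c : ℕ), c < ν i ↔ 2 ≤ T.val ((i : ℕ), c) := by
      intro i c
      have hzero : ∀ c, 2 ≤ T.val ((i : ℕ), c) → c < μ i.castSucc := by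
        intro c hc
        by_contra h
        rw [T.zero] at hc
        · omega
        · rw [mem_cells]
          rintro ⟨h1, h2⟩
          exact h h2
      constructor
      · intro hc
        by_contra h
        have : ν i ≤ (Finset.range c).card := by
          refine Finset.card_le_card fun c' hc' => ?_
          rw [Finset.mem_filter] at hc'
          rw [Finset.mem_range]
          by_contra h'
          exact h (hc'.2.trans (T.val_antitone i (not_lt.1 h')))
        rw [Finset.card_range] at this
        omega
      · intro hc
        have : (Finset.range (c + 1)).card ≤ ν i := by
          refine Finset.card_le_card fun c' hc' => ?_
          rw [Finset.mem_range] at hc'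
          have h2 := hc.trans (T.val_antitone i (Nat.lt_succ_iff.1 hc'))
          exact Finset.mem_filter.2 ⟨Finset.mem_range.2 (hzero _ h2), h2⟩
        rw [Finset.card_range] at this
        omega
    have hmem : ν ∈ interlacing μ := by
      rw [mem_interlacing]
      intro i
      constructor
      · by_contra h
        rw [not_le] at h
        have h1 : ((i : ℕ) + 1, ν i) ∈ cells (d + 1) μ := mem_cells.2 ⟨by omega, h⟩
        have h2 := T.col _ _ h1
        have h3 := (T.mem _ h1).1
        exact lt_irrefl _ ((hlt i (ν i)).2 (by omega))
      · simpa using Finset.card_filter_le (Finset.range (μ i.castSucc)) _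
    have hcells : ∀ r c, (r, c) ∈ cells d ν ↔ 2 ≤ T.val (r, c) := by
      intro r c
      rw [mem_cells]
      constructor
      · rintro ⟨hr, hc⟩
        exact (hlt ⟨r, hr⟩ c).1 hc
      · intro h
        have h1 : (r, c) ∈ cells (d + 1) μ := by
          by_contra h'
          rw [T.zero _ h'] at h
          omega
        have := T.val_add_row_le hμ h1
        exact ⟨by omega, (hlt ⟨r, by omega⟩ c).2 h⟩
    refine ⟨⟨⟨ν, hmem⟩, ⟨fun a => T.val a - 1, ?_, ?_, ?_, ?_⟩⟩, ?_⟩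
    · rintro ⟨r, c⟩ h
      have := (hcells r c).1 h
      have := T.val_le (r, c)
      omega
    · rintro ⟨r, c⟩ h
      have h' : ¬2 ≤ T.val (r, c) := fun h' => h ((hcells r c).2 h')
      show T.val (r, c) - 1 = 0
      omega
    · intro r c _
      exact Nat.sub_le_sub_right (T.val_antitone r (Nat.le_succ c)) 1
    · intro r c h
      have h1 := (hcells _ _).1 h
      have h2 := T.col r c (cells_subset_of_mem_interlacing hmem h)
      omega
    · refine RevTableau.ext_val (funext fun a => ?_)
      by_cases ha : a ∈ cells (d + 1) μ
      · rw [RevTableau.extend_val _ _ ha]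
        have := (T.mem a ha).1
        simp only
        omega
      · rw [RevTableau.zero _ a ha, T.zero a ha]

variable {A : Type*} [CommRing A]

/-- The factorial Schur function, as a sum over reverse tableaux, in an arbitrary
commutative ring. -/
def tabSum (y : ℤ → A) (x : ℕ → A) (d : ℕ) (μ : Fin d → ℕ) : A :=
  ∑ R : RevTableau d μ, ∏ a ∈ cells d μ,
    (x (R.val a - 1) - y ((d : ℤ) + 1 - (R.val a : ℤ) + (a.2 : ℤ) - (a.1 : ℤ)))

lemma prod_cells_extend (y : ℤ → A) (x : ℕ → A) {d : ℕ} {μ : Fin (d + 1) → ℕ} {ν : Fin d → ℕ}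
    (hν : ν ∈ interlacing μ) (R : RevTableau d ν) :
    ∏ a ∈ cells (d + 1) μ, (x ((R.extend hν).val a - 1) -
        y (((d + 1 : ℕ) : ℤ) + 1 - ((R.extend hν).val a : ℤ) + (a.2 : ℤ) - (a.1 : ℤ))) =
      stripWeight y (x 0) μ ν * ∏ a ∈ cells d ν, (x (R.val a - 1 + 1) -
        y ((d : ℤ) + 1 - (R.val a : ℤ) + (a.2 : ℤ) - (a.1 : ℤ))) := by
  have h1 : ∀ a ∈ cells (d + 1) μ, (x ((R.extend hν).val a - 1) -
        y (((d + 1 : ℕ) : ℤ) + 1 - ((R.extend hν).val a : ℤ) + (a.2 : ℤ) - (a.1 : ℤ))) =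
      x (R.val a) - y ((d : ℤ) + 1 - (R.val a : ℤ) + (a.2 : ℤ) - (a.1 : ℤ)) := by
    intro a ha
    rw [RevTableau.extend_val _ _ ha]
    congr 2
    push_cast
    ring
  have h2 : ∀ a ∈ cells d ν, (x (R.val a - 1 + 1) -
        y ((d : ℤ) + 1 - (R.val a : ℤ) + (a.2 : ℤ) - (a.1 : ℤ))) =
      x (R.val a) - y ((d : ℤ) + 1 - (R.val a : ℤ) + (a.2 : ℤ) - (a.1 : ℤ)) := by
    intro a ha
    rw [Nat.sub_add_cancel (R.mem a ha).1]
  rw [Finset.prod_congr rfl h1, Finset.prod_congr rfl h2, prod_cells, prod_cells,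
    Fin.prod_univ_castSucc, stripWeight, mul_right_comm, ← Finset.prod_mul_distrib]
  congr 1
  · refine Finset.prod_congr rfl fun i _ => ?_
    rw [mul_comm, ← Finset.prod_range_mul_prod_Ico _ (mem_interlacing.1 hν i).2]
    congr 1
    refine Finset.prod_congr rfl fun c hc => ?_
    rw [R.zero]
    · simp
    · rw [mem_cells]
      rintro ⟨h, h'⟩
      exact absurd h' (not_lt.2 (Finset.mem_Ico.1 hc).1)
  · refine Finset.prod_congr rfl fun c _ => ?_
    rw [R.zero]
    · congr 2
      simp
      ring
    · rw [mem_cells]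
      rintro ⟨h, _⟩
      exact absurd h (by simp)

lemma tabSum_succ (y : ℤ → A) (x : ℕ → A) {d : ℕ} (μ : Fin (d + 1) → ℕ)
    (hμ : IsPartitionVec μ) :
    tabSum y x (d + 1) μ = ∑ ν ∈ interlacing μ,
      stripWeight y (x 0) μ ν * tabSum y (fun n => x (n + 1)) d ν := by
  rw [tabSum, ← (Equiv.ofBijective _ (RevTableau.extend_bijective hμ)).sum_comp,
    Fintype.sum_sigma, ← Finset.sum_coe_sort (interlacing μ) fun ν =>
      stripWeight y (x 0) μ ν * tabSum y (fun n => x (n + 1)) d ν]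
  refine Finset.sum_congr rfl fun ν _ => ?_
  rw [tabSum, Finset.mul_sum]
  exact Finset.sum_congr rfl fun R _ => prod_cells_extend y x ν.2 R

/-- The bialternant formula for factorial Schur functions. -/
lemma altDet_eq_mul_tabSum (y : ℤ → A) (x : ℕ → A) {d : ℕ} (μ : Fin d → ℕ)
    (hμ : IsPartitionVec μ) :
    altDet y x d (fun i => μ i + rho d i) =
      (∏ i : Fin d, ∏ j ∈ Finset.Ioi i, (x i - x j)) * tabSum y x d μ := by
  induction d generalizing x with
  | zero =>
    have : Nonempty (RevTableau 0 μ) :=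
      ⟨⟨fun _ => 0, by simp [cells], fun _ _ => rfl, by simp, by simp [cells]⟩⟩
    have : Unique (RevTableau 0 μ) := by
      refine @Unique.mk' _ ⟨this.some⟩ ⟨fun R S => RevTableau.ext_val (funext fun a => ?_)⟩
      have h : a ∉ cells 0 μ := by simp [cells]
      rw [R.zero a h, S.zero a h]
    have h : cells 0 μ = ∅ := by simp [cells]
    simp [altDet, tabSum, h]
  | succ d ih =>
    rw [altDet_succ y x μ hμ, tabSum_succ y x μ hμ, Fin.prod_univ_succ,
      Fin.prod_Ioi_zero (fun j : Fin (d + 1) => x (0 : Fin (d + 1)) - x j), mul_assoc]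
    congr 1
    rw [Finset.mul_sum]
    refine Finset.sum_congr rfl fun ν hν => ?_
    rw [ih _ ν (isPartitionVec_of_mem_interlacing hμ hν), mul_left_comm]
    congr 1
    refine Finset.prod_congr rfl fun i _ => ?_
    rw [Fin.prod_Ioi_succ (fun j : Fin (d + 1) => x i.succ - x j)]
    rfl

end Tableaux

section Expansion

variable {A : Type*} [CommRing A]

/-- The reading order of a reverse diagram as a map to a linear order. -/
def readingPos (a : ℕ × ℕ) : ℕ ×ₗ ℕᵒᵈ := toLex (a.2, OrderDual.toDual a.1)

lemma revBefore_iff {a b : ℕ × ℕ} : revBefore a b ↔ readingPos b < readingPos a := by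
  simp [revBefore, readingPos, Prod.Lex.toLex_lt_toLex]

lemma readingPos_injective : Function.Injective readingPos := by
  rintro ⟨a, b⟩ ⟨c, e⟩ h
  simp only [readingPos, EmbeddingLike.apply_eq_iff_eq, Prod.mk.injEq] at h
  rw [h.1, h.2]

/-- Expanding a product of linear factors one at a time in the falling factorial basis. -/
lemma prod_fallPow_mul_prod_sub (y : ℤ → A) (x : ℕ → A) (J : Finset ℕ) (ξ : ℕ → ℕ)
    (v : ℕ × ℕ → ℕ) (g : ℕ × ℕ → A) (s : Finset (ℕ × ℕ)) (hs : ∀ a ∈ s, v a ∈ J) :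
    (∏ k ∈ J, fallPow y (x k) (ξ k)) * ∏ a ∈ s, (x (v a) - g a) =
      ∑ T ∈ s.powerset,
        (∏ a ∈ T, (y ((ξ (v a) : ℤ) + 1 +
          ((s.filter fun b => b ∉ T ∧ v b = v a ∧ revBefore a b).card : ℤ)) - g a)) *
        ∏ k ∈ J, fallPow y (x k) (ξ k + (s.filter fun b => b ∉ T ∧ v b = k).card) := by
  induction s using Finset.induction_on_max_value readingPos with
  | empty => simp
  | insert a s ha hmax ih =>
    have hbefore : ∀ b ∈ s, revBefore a b := fun b hb => revBefore_iff.2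
      ((hmax b hb).lt_of_ne fun h => ha (readingPos_injective h ▸ hb))
    have hnot : ∀ b ∈ insert a s, ¬revBefore b a := by
      intro b hb
      rw [revBefore_iff, not_lt]
      rcases Finset.mem_insert.1 hb with rfl | hb
      · exact le_rfl
      · exact hmax b hb
    rw [Finset.prod_insert ha, mul_left_comm, ih fun b hb => hs b (Finset.mem_insert_of_mem hb),
      Finset.sum_powerset_insert ha, ← Finset.sum_add_distrib, Finset.mul_sum]
    refine Finset.sum_congr rfl fun T hT => ?_
    rw [Finset.mem_powerset] at hT
    have haT : a ∉ T := fun h => ha (hT h)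
    have hvJ : v a ∈ J := hs a (Finset.mem_insert_self a s)
    have hcoef : ∀ T' : Finset (ℕ × ℕ), (∀ b ∈ s, b ∈ T' ↔ b ∈ T) →
        ∏ b ∈ T, (y ((ξ (v b) : ℤ) + 1 + (((insert a s).filter
          fun e => e ∉ T' ∧ v e = v b ∧ revBefore b e).card : ℤ)) - g b) =
        ∏ b ∈ T, (y ((ξ (v b) : ℤ) + 1 +
          ((s.filter fun e => e ∉ T ∧ v e = v b ∧ revBefore b e).card : ℤ)) - g b) := by
      intro T' hT'
      refine Finset.prod_congr rfl fun b hb => ?_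
      rw [Finset.filter_insert, if_neg fun h => hnot b (Finset.mem_insert_of_mem (hT hb)) h.2.2,
        Finset.filter_congr fun e he => by rw [hT' e he]]
    have hiff : ∀ b ∈ s, b ∈ insert a T ↔ b ∈ T := by
      intro b hb
      rw [Finset.mem_insert, or_iff_right]
      rintro rfl
      exact ha hb
    set m : ℕ := (s.filter fun b => b ∉ T ∧ v b = v a).card with hm
    have hbarred : ∀ k, ((insert a s).filter fun b => b ∉ insert a T ∧ v b = k).card =
        (s.filter fun b => b ∉ T ∧ v b = k).card := by
      intro k
      rw [Finset.filter_insert, if_neg (by simp)]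
      congr 1
      exact Finset.filter_congr fun b hb => by rw [hiff b hb]
    have hlast : ((insert a s).filter fun b => b ∉ insert a T ∧ v b = v a ∧ revBefore a b).card =
        m := by
      rw [Finset.filter_insert, if_neg (by simp), hm]
      congr 1
      exact Finset.filter_congr fun b hb => by rw [hiff b hb]; simp [hbefore b hb]
    have hunbarred : ∏ k ∈ J, fallPow y (x k)
          (ξ k + ((insert a s).filter fun b => b ∉ T ∧ v b = k).card) =
        (x (v a) - y ((ξ (v a) : ℤ) + 1 + (m : ℤ))) * ∏ k ∈ J, fallPow y (x k)
          (ξ k + (s.filter fun b => b ∉ T ∧ v b = k).card) := by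
      rw [← Finset.mul_prod_erase J _ hvJ, ← Finset.mul_prod_erase J _ hvJ, ← mul_assoc]
      congr 1
      · rw [Finset.filter_insert, if_pos ⟨haT, rfl⟩, Finset.card_insert_of_notMem (by simp [ha]),
          ← hm, ← add_assoc, fallPow_succ, mul_comm]
        congr 3
        push_cast
        ring
      · refine Finset.prod_congr rfl fun k hk => ?_
        rw [Finset.filter_insert, if_neg fun h => (Finset.ne_of_mem_erase hk) h.2.symm]
    rw [Finset.prod_insert haT, hlast, hunbarred]
    simp only [hbarred]
    rw [hcoef T fun _ _ => Iff.rfl, hcoef (insert a T) hiff]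
    ring

/-- Bar the entries of a reverse tableau in a given set of cells. -/
def RevTableau.bar {d : ℕ} {μ : Fin d → ℕ} (R : RevTableau d μ) (T : Finset (ℕ × ℕ))
    (hT : T ∈ (cells d μ).powerset) : RevBarredTableau d μ where
  val := R.val
  barred := fun a => a ∈ T
  mem := R.mem
  zero := R.zero
  barred_sub _ ha := Finset.mem_powerset.1 hT ha
  row := R.row
  col := R.col

lemma RevTableau.bar_bijective {d : ℕ} {μ : Fin d → ℕ} :
    Function.Bijective fun p : RevTableau d μ × (cells d μ).powerset => p.1.bar p.2.1 p.2.2 := by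
  constructor
  · rintro ⟨R, T, hT⟩ ⟨S, U, hU⟩ h
    have h1 : R.val = S.val := congrArg RevBarredTableau.val h
    have h2 : (fun a => a ∈ T) = fun a => a ∈ U := congrArg RevBarredTableau.barred h
    obtain rfl : T = U := Finset.ext fun a => iff_of_eq (congrFun h2 a)
    rw [RevTableau.ext_val h1]
  · intro B
    refine ⟨⟨⟨B.val, B.mem, B.zero, B.row, B.col⟩, (cells d μ).filter fun a => B.barred a,
      Finset.mem_powerset.2 (Finset.filter_subset _ _)⟩, ?_⟩
    have h : (fun a => a ∈ (cells d μ).filter fun a => B.barred a) = B.barred := by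
      ext a
      rw [Finset.mem_filter]
      exact ⟨fun h => h.2, fun h => ⟨B.barred_sub a h, h⟩⟩
    cases B
    simpa only [RevTableau.bar, RevBarredTableau.mk.injEq, true_and] using h

lemma vecAt_succ {d : ℕ} (ξ : Fin d → ℕ) (i : Fin d) : vecAt ξ ((i : ℕ) + 1) = ξ i := by
  simp [vecAt]

/-- Extend a vector of ring elements by zero. -/
def extendZero {d : ℕ} (u : Fin d → A) (n : ℕ) : A := if h : n < d then u ⟨n, h⟩ else 0

@[simp]
lemma extendZero_val {d : ℕ} (u : Fin d → A) (i : Fin d) : extendZero u i = u i := by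
  simp [extendZero]

/-- The expansion of `(x|y)^ξ · s_μ(x|y)` over reverse barred tableaux. -/
lemma prod_fallPow_mul_tabSum {d : ℕ} (u : Fin d → P d) (ξ μ : Fin d → ℕ) :
    (∏ j, fallPow (yI d) (u j) (ξ j)) * tabSum (yI d) (extendZero u) d μ =
      ∑ p : RevTableau d μ × (cells d μ).powerset,
        (p.1.bar p.2.1 p.2.2).cXi (fun i => ξ i + 1) *
          ∏ j : Fin d, fallPow (yI d) (u j)
            (ξ j + (p.1.bar p.2.1 p.2.2).content ((j : ℕ) + 1)) := by
  have hJ : ∀ f : ℕ → P d, ∏ k ∈ Finset.univ.image (fun i : Fin d => (i : ℕ) + 1), f k =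
      ∏ i : Fin d, f ((i : ℕ) + 1) := fun f =>
    Finset.prod_image fun i _ j _ h => Fin.ext (Nat.succ_injective h)
  have hR : ∀ (R : RevTableau d μ), ∀ a ∈ cells d μ, ∃ i : Fin d, (i : ℕ) + 1 = R.val a := by
    intro R a ha
    obtain ⟨h1, h2⟩ := R.mem a ha
    exact ⟨⟨R.val a - 1, by omega⟩, Nat.sub_add_cancel h1⟩
  rw [tabSum, Finset.mul_sum, Fintype.sum_prod_type]
  refine Finset.sum_congr rfl fun R _ => ?_
  have h := prod_fallPow_mul_prod_sub (yI d) (fun k => extendZero u (k - 1))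
    (Finset.univ.image fun i : Fin d => (i : ℕ) + 1) (vecAt ξ) R.val
    (fun a => yI d ((d : ℤ) + 1 - (R.val a : ℤ) + (a.2 : ℤ) - (a.1 : ℤ))) (cells d μ)
    (fun a ha => by simpa using hR R a ha)
  simp only [hJ, vecAt_succ, Nat.add_sub_cancel, extendZero_val] at h
  rw [h, ← Finset.sum_coe_sort]
  refine Finset.sum_congr rfl fun T _ => ?_
  have hfilter : (cells d μ).filter (fun a => (R.bar T.1 T.2).barred a) = T.1 := by
    ext a
    rw [Finset.mem_filter]
    exact ⟨fun h => h.2, fun h => ⟨Finset.mem_powerset.1 T.2 h, h⟩⟩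
  have hcontent : ∀ k, (R.bar T.1 T.2).content k =
      ((cells d μ).filter fun b => b ∉ T.1 ∧ R.val b = k).card := by
    intro k
    unfold RevBarredTableau.content RevTableau.bar
    congr!
  simp only [RevBarredTableau.cXi, hfilter, hcontent]
  congr 1
  refine Finset.prod_congr rfl fun a ha => ?_
  obtain ⟨i, hi⟩ := hR R a (Finset.mem_powerset.1 T.2 ha)
  congr 2
  have hv : (R.bar T.1 T.2).val = R.val := rfl
  rw [RevBarredTableau.eIdx, hv, ← hi, vecAt_succ, vecAt_succ, hi]
  have hcount : (R.bar T.1 T.2).countBefore a (R.val a) =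
      ((cells d μ).filter fun b => b ∉ T.1 ∧ R.val b = R.val a ∧ revBefore a b).card := by
    unfold RevBarredTableau.countBefore RevTableau.bar
    congr!
  rw [hcount]
  push_cast
  rfl

lemma altDet_comp_perm (y : ℤ → A) {d : ℕ} (u : Fin d → A) (σ : Equiv.Perm (Fin d))
    (ξ : Fin d → ℕ) :
    altDet y (extendZero (u ∘ σ)) d ξ = Equiv.Perm.sign σ * altDet y (extendZero u) d ξ := by
  rw [altDet, altDet, ← Matrix.det_permute']
  congr 1
  ext i j
  simp

lemma prod_sub_comp_perm {d : ℕ} (u : Fin d → A) (σ : Equiv.Perm (Fin d)) :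
    ∏ i : Fin d, ∏ j ∈ Finset.Ioi i, (u (σ i) - u (σ j)) =
      Equiv.Perm.sign σ * ∏ i : Fin d, ∏ j ∈ Finset.Ioi i, (u i - u j) := by
  have h : ∀ w : Fin d → A, ∏ i : Fin d, ∏ j ∈ Finset.Ioi i, (w i - w j) =
      (Matrix.vandermonde fun i => -w i).det := by
    intro w
    rw [Matrix.det_vandermonde]
    simp only [neg_sub_neg]
  rw [h u, h fun i => u (σ i), ← Matrix.det_permute]
  rfl

/-- Factorial Schur functions are symmetric. -/
lemma tabSum_comp_perm [IsDomain A] (y : ℤ → A) {d : ℕ} {u : Fin d → A}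
    (hu : Function.Injective u) (σ : Equiv.Perm (Fin d)) {μ : Fin d → ℕ}
    (hμ : IsPartitionVec μ) :
    tabSum y (extendZero (u ∘ σ)) d μ = tabSum y (extendZero u) d μ := by
  have h1 := altDet_eq_mul_tabSum y (extendZero (u ∘ σ)) μ hμ
  rw [altDet_comp_perm, altDet_eq_mul_tabSum y (extendZero u) μ hμ] at h1
  simp only [extendZero_val, Function.comp_apply] at h1
  rw [prod_sub_comp_perm, mul_assoc] at h1
  have hsign : ((Equiv.Perm.sign σ : ℤ) : A) ≠ 0 := by
    rcases Int.units_eq_one_or (Equiv.Perm.sign σ) with h | h <;> simp [h]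
  have hne : ∏ i : Fin d, ∏ j ∈ Finset.Ioi i, (u i - u j) ≠ 0 :=
    Finset.prod_ne_zero_iff.2 fun i _ => Finset.prod_ne_zero_iff.2 fun j hj =>
      sub_ne_zero.2 fun h => (Finset.mem_Ioi.1 hj).ne (hu h)
  exact (mul_left_cancel₀ hne (mul_left_cancel₀ hsign h1)).symm

lemma aDet_eq_sum (d : ℕ) (ξ : Fin d → ℕ) :
    aDet d ξ = ∑ σ : Equiv.Perm (Fin d), ((Equiv.Perm.sign σ : ℤ) : P d) *
      ∏ j, fallPow (yI d) (X (Sum.inl (σ j))) (ξ j) := by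
  rw [aDet, ← Matrix.det_transpose, Matrix.det_apply']
  rfl

lemma fSchur_eq_tabSum (d : ℕ) (μ : Fin d → ℕ) :
    fSchur d μ = tabSum (yI d) (extendZero fun j : Fin d => X (Sum.inl j)) d μ := by
  rw [fSchur, finsum_eq_sum_of_fintype]
  rfl

end Expansion

/-- Key expansion:
`a_{λ+ρ}(x|y) · s_μ(x|y) = Σ_{B ∈ B(μ)} c_{λ*B} · a_{λ+ρ+ω(B^u)}(x|y)`,
summed over all reverse barred tableaux `B` of shape `μ`, where `c_{λ*B} = c_{λ+ρ+1,B}`. -/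
theorem key_expansion (d : ℕ) (hd : 1 ≤ d)
    (lam mu : Fin d → ℕ) (hlam : IsPartitionVec lam) (hmu : IsPartitionVec mu) :
    aDet d (fun i => lam i + rho d i) * fSchur d mu =
      ∑ᶠ B : RevBarredTableau d mu,
        B.cXi (fun i => lam i + rho d i + 1) *
          aDet d (fun i => lam i + rho d i + B.content ((i : ℕ) + 1)) := by
  have hinj : Function.Injective fun j : Fin d => (X (Sum.inl j) : P d) :=
    (X_injective (R := ℂ)).comp Sum.inl_injective
  rw [← finsum_comp _ RevTableau.bar_bijective, finsum_eq_sum_of_fintype, fSchur_eq_tabSum,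
    aDet_eq_sum, Finset.sum_mul]
  simp only [aDet_eq_sum, Finset.mul_sum]
  rw [Finset.sum_comm]
  refine Finset.sum_congr rfl fun σ _ => ?_
  rw [← tabSum_comp_perm (yI d) hinj σ hmu, mul_assoc]
  have h := prod_fallPow_mul_tabSum ((fun j : Fin d => (X (Sum.inl j) : P d)) ∘ σ)
    (fun i => lam i + rho d i) mu
  simp only [Function.comp_apply] at h
  rw [h, Finset.mul_sum]
  exact Finset.sum_congr rfl fun p _ => mul_left_comm _ _ _

end EqLR
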